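/- arXiv:2603.20228 — 6 statements merged into one kernel-verified Lean document; each statement's English description precedes it below -/
import Mathlib

section
/- Proposition 1 (lifted relaxation). For every pair (X, Y) feasible for the rank-constrained problem (P), the lifted point (X, Y, W_xx, W_xy, W_yy) with W_xx = vec(Xᵀ)vec(Xᵀ)ᵀ, W_xy = vec(Xᵀ)vec(Y)ᵀ and W_yy = vec(Y)vec(Y)ᵀ is feasible for the semidefinite problem (R) and attains the same objective value. Consequently, the optimal value of (R) is less than or equal to the optimal value of (P), i.e., (R) is a valid convex relaxation of (P). -/
open Matrix BigOperators

noncomputable section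

/-- Frobenius (trace) inner product of two real matrices. -/
def fip {α β : Type*} [Fintype α] [Fintype β] (A B : Matrix α β ℝ) : ℝ :=
  ∑ i, ∑ j, A i j * B i j

/-- Outer product `u vᵀ` of two vectors. -/
def outer {α β : Type*} (u : α → ℝ) (v : β → ℝ) : Matrix α β ℝ :=
  Matrix.of fun i j => u i * v j

/-- `vec(Xᵀ) ∈ ℝ^{nm}`, indexed by pairs `(i,j) ∈ [n]×[m]` with value `X i j`. -/
def vecXT {n m : ℕ} (X : Matrix (Fin n) (Fin m) ℝ) : Fin n × Fin m → ℝ :=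
  fun p => X p.1 p.2

/-- `vec(Y) ∈ ℝ^{n·n}` (columns stacked), indexed by pairs `(i,j)` with value `Y j i`. -/
def vecSq {n : ℕ} (Y : Matrix (Fin n) (Fin n) ℝ) : Fin n × Fin n → ℝ :=
  fun p => Y p.2 p.1

/-- The `(1 + nm + n·n)`-dimensional moment matrix
`[[1, vec(Xᵀ)ᵀ, vec(Y)ᵀ], [vec(Xᵀ), Wxx, Wxy], [vec(Y), Wxyᵀ, Wyy]]`. -/
def bigMat {n m : ℕ} (X : Matrix (Fin n) (Fin m) ℝ) (Y : Matrix (Fin n) (Fin n) ℝ)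
    (Wxx : Matrix (Fin n × Fin m) (Fin n × Fin m) ℝ)
    (Wxy : Matrix (Fin n × Fin m) (Fin n × Fin n) ℝ)
    (Wyy : Matrix (Fin n × Fin n) (Fin n × Fin n) ℝ) :
    Matrix (Unit ⊕ ((Fin n × Fin m) ⊕ (Fin n × Fin n)))
           (Unit ⊕ ((Fin n × Fin m) ⊕ (Fin n × Fin n))) ℝ :=
  Matrix.fromBlocks (Matrix.of fun _ _ => (1 : ℝ))
    (Matrix.of fun _ q => Sum.elim (vecXT X) (vecSq Y) q)
    (Matrix.of fun p _ => Sum.elim (vecXT X) (vecSq Y) p)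
    (Matrix.fromBlocks Wxx Wxy Wxyᵀ Wyy)

/-- Feasibility for the lifted relaxation (R). -/
def FeasR {n m : ℕ} (k : ℕ) {ι : Type}
    (Q : ι → Matrix (Fin n × Fin m) (Fin n × Fin m) ℝ)
    (E : ι → Matrix (Fin n) (Fin m) ℝ) (b : ι → ℝ)
    (X : Matrix (Fin n) (Fin m) ℝ) (Y : Matrix (Fin n) (Fin n) ℝ)
    (Wxx : Matrix (Fin n × Fin m) (Fin n × Fin m) ℝ)
    (Wxy : Matrix (Fin n × Fin m) (Fin n × Fin n) ℝ)
    (Wyy : Matrix (Fin n × Fin n) (Fin n × Fin n) ℝ) : Prop :=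
  Y.PosSemidef ∧ (1 - Y).PosSemidef ∧ Y.trace ≤ (k : ℝ) ∧
  Wxx.IsSymm ∧ Wyy.IsSymm ∧
  (bigMat X Y Wxx Wxy Wyy).PosSemidef ∧
  (∀ j ℓ : Fin n, ∑ i : Fin n, Wyy (i, j) (i, ℓ) = Y j ℓ) ∧
  (∀ j : Fin m, ∀ ℓ : Fin n, ∑ i : Fin n, Wxy (i, j) (i, ℓ) = X ℓ j) ∧
  (∀ i : ι, fip (Q i) Wxx + fip (E i) X ≤ b i)

/-- Feasibility for the compact relaxation (C). -/
def FeasC {n m : ℕ} (k : ℕ) {ι : Type}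
    (Q : ι → Matrix (Fin n × Fin m) (Fin n × Fin m) ℝ)
    (E : ι → Matrix (Fin n) (Fin m) ℝ) (b : ι → ℝ)
    (X : Matrix (Fin n) (Fin m) ℝ) (Y : Matrix (Fin n) (Fin n) ℝ)
    (W : Matrix (Fin n × Fin m) (Fin n × Fin m) ℝ) : Prop :=
  Y.PosSemidef ∧ (1 - Y).PosSemidef ∧ Y.trace ≤ (k : ℝ) ∧
  W.IsSymm ∧
  (W - outer (vecXT X) (vecXT X)).PosSemidef ∧
  (∀ i : ι, fip (Q i) W + fip (E i) X ≤ b i) ∧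
  (Matrix.fromBlocks (Matrix.of fun j ℓ => ∑ i : Fin n, W (i, j) (i, ℓ)) Xᵀ X Y).PosSemidef

/-- Feasibility for the rank-constrained problem (P). -/
def FeasP {n m : ℕ} (k : ℕ) {ι : Type}
    (Q : ι → Matrix (Fin n × Fin m) (Fin n × Fin m) ℝ)
    (E : ι → Matrix (Fin n) (Fin m) ℝ) (b : ι → ℝ)
    (X : Matrix (Fin n) (Fin m) ℝ) (Y : Matrix (Fin n) (Fin n) ℝ) : Prop :=
  Y.PosSemidef ∧ Y * Y = Y ∧ Y.trace ≤ (k : ℝ) ∧ X = Y * X ∧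
  (∀ i : ι, fip (Q i) (outer (vecXT X) (vecXT X)) + fip (E i) X ≤ b i)

/-- Proposition 1 (lifted relaxation): any point feasible for (P), once lifted via the
outer products `Wxx = vec(Xᵀ)vec(Xᵀ)ᵀ`, `Wxy = vec(Xᵀ)vec(Y)ᵀ`, `Wyy = vec(Y)vec(Y)ᵀ`,
is feasible for (R) with the same objective value; consequently the optimal value of (R)
is at most that of (P). -/
theorem lifted_relaxation (n m k : ℕ) (ι : Type) [Fintype ι]
    (lam : ℝ) (hlam : 0 ≤ lam)
    (H : Matrix (Fin n × Fin m) (Fin n × Fin m) ℝ) (hH : H.IsSymm)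
    (Q : ι → Matrix (Fin n × Fin m) (Fin n × Fin m) ℝ) (hQ : ∀ i, (Q i).IsSymm)
    (D : Matrix (Fin n) (Fin m) ℝ) (E : ι → Matrix (Fin n) (Fin m) ℝ) (b : ι → ℝ) :
    (∀ (X : Matrix (Fin n) (Fin m) ℝ) (Y : Matrix (Fin n) (Fin n) ℝ),
      FeasP k Q E b X Y →
        FeasR k Q E b X Y (outer (vecXT X) (vecXT X)) (outer (vecXT X) (vecSq Y))
          (outer (vecSq Y) (vecSq Y)) ∧
        lam * Y.trace + fip (outer (vecXT X) (vecXT X)) H + fip D X =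
          lam * Y.trace + fip H (outer (vecXT X) (vecXT X)) + fip D X) ∧
    sInf {v : EReal | ∃ (X : Matrix (Fin n) (Fin m) ℝ) (Y : Matrix (Fin n) (Fin n) ℝ)
        (Wxx : Matrix (Fin n × Fin m) (Fin n × Fin m) ℝ)
        (Wxy : Matrix (Fin n × Fin m) (Fin n × Fin n) ℝ)
        (Wyy : Matrix (Fin n × Fin n) (Fin n × Fin n) ℝ),
        FeasR k Q E b X Y Wxx Wxy Wyy ∧
        v = ((lam * Y.trace + fip Wxx H + fip D X : ℝ) : EReal)} ≤
    sInf {v : EReal | ∃ (X : Matrix (Fin n) (Fin m) ℝ) (Y : Matrix (Fin n) (Fin n) ℝ),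
        FeasP k Q E b X Y ∧
        v = ((lam * Y.trace + fip H (outer (vecXT X) (vecXT X)) + fip D X : ℝ) : EReal)} := by
  have key : ∀ (X : Matrix (Fin n) (Fin m) ℝ) (Y : Matrix (Fin n) (Fin n) ℝ),
      FeasP k Q E b X Y →
        FeasR k Q E b X Y (outer (vecXT X) (vecXT X)) (outer (vecXT X) (vecSq Y))
          (outer (vecSq Y) (vecSq Y)) ∧
        lam * Y.trace + fip (outer (vecXT X) (vecXT X)) H + fip D X =
          lam * Y.trace + fip H (outer (vecXT X) (vecXT X)) + fip D X := by
    rintro X Y ⟨hY, hYY, htr, hX, hc⟩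
    have hs : ∀ i j, Y i j = Y j i := fun i j => by
      have := hY.isHermitian.apply j i
      simpa using this
    refine ⟨⟨hY, ?_, htr, ?_, ?_, ?_, ?_, ?_, hc⟩, ?_⟩
    · have hT : (1 - Y)ᴴ = 1 - Y := by
        rw [Matrix.conjTranspose_sub, Matrix.conjTranspose_one, hY.isHermitian.eq]
      have h1 : (1 - Y)ᴴ * (1 - Y) = 1 - Y := by
        rw [hT, Matrix.mul_sub, Matrix.sub_mul, Matrix.sub_mul, hYY]
        simp
      rw [← h1]
      exact Matrix.posSemidef_conjTranspose_mul_self _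
    · ext p q
      simp [outer, mul_comm]
    · ext p q
      simp [outer, mul_comm]
    · have h : bigMat X Y (outer (vecXT X) (vecXT X)) (outer (vecXT X) (vecSq Y))
          (outer (vecSq Y) (vecSq Y)) =
          Matrix.vecMulVec (Sum.elim (fun _ => (1 : ℝ)) (Sum.elim (vecXT X) (vecSq Y)))
            (star (Sum.elim (fun _ => (1 : ℝ)) (Sum.elim (vecXT X) (vecSq Y)))) := by
        ext p q
        rcases p with p | p | p <;> rcases q with q | q | q <;>
          simp [bigMat, outer, Matrix.vecMulVec_apply, mul_comm]
      rw [h]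
      exact Matrix.posSemidef_vecMulVec_self_star _
    · intro j l
      have h := congrFun (congrFun hYY j) l
      rw [Matrix.mul_apply] at h
      rw [← h]
      refine Finset.sum_congr rfl fun i _ => ?_
      simp only [outer, vecSq, Matrix.of_apply]
      rw [hs l i]
    · intro j l
      have h := congrFun (congrFun hX l) j
      rw [Matrix.mul_apply] at h
      rw [h]
      refine Finset.sum_congr rfl fun i _ => ?_
      simp only [outer, vecSq, vecXT, Matrix.of_apply]
      ring
    · simp only [fip, mul_comm]
  refine ⟨key, ?_⟩
  apply sInf_le_sInf
  rintro v ⟨X, Y, hP, rfl⟩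
  obtain ⟨hR, ho⟩ := key X Y hP
  exact ⟨X, Y, _, _, _, hR, by rw [ho]⟩
end
end

section
/- Theorem 1 (elimination theorem). The semidefinite problems (R) and (C) have equal optimal values. -/
open Matrix BigOperators

noncomputable section

/-- The range of `AᵀA` contains the columns of `AᵀC`. -/
theorem exists_gram_solve {r p q : Type*} [Fintype r] [Fintype p] [Fintype q]
    [DecidableEq p] [DecidableEq r] [DecidableEq q]
    (A : Matrix r p ℝ) (C : Matrix r q ℝ) : ∃ B : Matrix p q ℝ, Aᵀ * A * B = Aᵀ * C := by
  have hle : LinearMap.range (Aᵀ * A).mulVecLin ≤ LinearMap.range Aᵀ.mulVecLin := by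
    rintro _ ⟨v, rfl⟩
    exact ⟨A *ᵥ v, by simp⟩
  have heq : LinearMap.range (Aᵀ * A).mulVecLin = LinearMap.range Aᵀ.mulVecLin := by
    apply Submodule.eq_of_le_of_finrank_eq hle
    change (Aᵀ * A).rank = Aᵀ.rank
    rw [Matrix.rank_transpose_mul_self, Matrix.rank_transpose]
  have h : ∀ l : q, ∃ v : p → ℝ, (Aᵀ * A) *ᵥ v = Aᵀ *ᵥ (fun i => C i l) := by
    intro l
    have : Aᵀ *ᵥ (fun i => C i l) ∈ LinearMap.range (Aᵀ * A).mulVecLin := by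
      rw [heq]; exact ⟨_, rfl⟩
    obtain ⟨v, hv⟩ := this
    exact ⟨v, hv⟩
  choose f hf using h
  refine ⟨Matrix.of fun i l => f l i, ?_⟩
  ext i l
  exact congrFun (hf l) i

open scoped MatrixOrder in
theorem exists_solve_of_psd {p q : Type*} [Fintype p] [Fintype q] [DecidableEq p] [DecidableEq q]
    (P : Matrix p p ℝ) (G : Matrix p q ℝ) (T : Matrix q q ℝ)
    (h : (fromBlocks P G Gᵀ T).PosSemidef) :
    ∃ B : Matrix p q ℝ, P * B = G ∧ (T - Bᵀ * P * B).PosSemidef := by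
  obtain ⟨R, hR⟩ := (CStarAlgebra.nonneg_iff_eq_star_mul_self
    (a := fromBlocks P G Gᵀ T)).mp h.nonneg
  have hR' : fromBlocks P G Gᵀ T = Rᵀ * R := by
    rw [hR, star_eq_conjTranspose, conjTranspose_eq_transpose_of_trivial]
  have eP : P = R.toCols₁ᵀ * R.toCols₁ := by
    ext i j
    simpa [Matrix.mul_apply] using congrFun (congrFun hR' (Sum.inl i)) (Sum.inl j)
  have eG : G = R.toCols₁ᵀ * R.toCols₂ := by
    ext i j
    simpa [Matrix.mul_apply] using congrFun (congrFun hR' (Sum.inl i)) (Sum.inr j)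
  obtain ⟨B, hB⟩ := exists_gram_solve R.toCols₁ R.toCols₂
  rw [← eP, ← eG] at hB
  have hPt : Pᵀ = P := by rw [eP]; simp
  refine ⟨B, hB, ?_⟩
  have a := h.conjTranspose_mul_mul_same (fromRows (-B) 1)
  convert a using 1
  rw [conjTranspose_eq_transpose_of_trivial, transpose_fromRows,
    Matrix.mul_assoc ((-B)ᵀ.fromCols 1ᵀ), fromBlocks_mul_fromRows, fromCols_mul_fromRows, ← hB]
  simp [hPt, sub_eq_add_neg, add_comm, Matrix.mul_assoc]

theorem compact_psd {p q : Type*} [Fintype p] [Fintype q] [DecidableEq p] [DecidableEq q]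
    (P : Matrix p p ℝ) (X : Matrix q p ℝ) (Y : Matrix q q ℝ) (hY : Yᵀ = Y)
    (h1 : (1 - Y).PosSemidef) (h : (fromBlocks P Xᵀ X Y).PosSemidef) :
    (fromBlocks (P - Xᵀ * X) (Xᵀ * (1 - Y)) (Xᵀ * (1 - Y))ᵀ (Y - Y * Y)).PosSemidef := by
  have a := h.conjTranspose_mul_mul_same (fromBlocks (1 : Matrix p p ℝ) 0 (-X) (1 - Y))
  have b := h1.conjTranspose_mul_mul_same (fromCols X Y)
  convert a.add b using 1
  rw [conjTranspose_eq_transpose_of_trivial, conjTranspose_eq_transpose_of_trivial,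
    fromBlocks_transpose, transpose_fromCols, fromBlocks_multiply, fromBlocks_multiply,
    fromRows_mul, fromRows_mul_fromCols, fromBlocks_add]
  simp only [transpose_mul, transpose_sub, transpose_one, hY, transpose_transpose, transpose_neg,
    transpose_zero]
  congr 1 <;> simp [Matrix.mul_add, Matrix.mul_sub, Matrix.sub_mul, Matrix.add_mul, Matrix.mul_assoc] <;> abel

open scoped Kronecker in
theorem lift_psd {n m : ℕ} (X : Matrix (Fin n) (Fin m) ℝ) (Y : Matrix (Fin n) (Fin n) ℝ)
    (V : Matrix (Fin n × Fin m) (Fin n × Fin m) ℝ)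
    (Z : Matrix (Fin n × Fin m) (Fin n × Fin n) ℝ) (N : Matrix (Fin n × Fin n) (Fin n × Fin n) ℝ)
    (hV : V.PosSemidef) (hN : N.PosSemidef) :
    (bigMat X Y (V + outer (vecXT X) (vecXT X)) (V * Z + outer (vecXT X) (vecSq Y))
      (Zᵀ * V * Z + N + outer (vecSq Y) (vecSq Y))).PosSemidef := by
  have hVt : Vᵀ = V := by simpa using hV.isHermitian.eq
  have a := hV.conjTranspose_mul_mul_same
    (fromCols (0 : Matrix (Fin n × Fin m) Unit ℝ) (fromCols (1 : Matrix (Fin n × Fin m) (Fin n × Fin m) ℝ) Z))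
  have b := hN.conjTranspose_mul_mul_same
    (fromCols (0 : Matrix (Fin n × Fin n) Unit ℝ)
      (fromCols (0 : Matrix (Fin n × Fin n) (Fin n × Fin m) ℝ) (1 : Matrix (Fin n × Fin n) (Fin n × Fin n) ℝ)))
  have c := posSemidef_vecMulVec_self_star
    (Sum.elim (fun _ : Unit => (1 : ℝ)) (Sum.elim (vecXT X) (vecSq Y)))
  convert (a.add b).add c using 1
  simp only [conjTranspose_eq_transpose_of_trivial, transpose_fromCols, fromRows_mul,
    fromRows_mul_fromCols, mul_fromCols, transpose_zero, transpose_one, Matrix.zero_mul,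
    Matrix.mul_zero, Matrix.one_mul, Matrix.mul_one]
  ext (_ | i | i) (_ | j | j) <;>
    simp [bigMat, outer, vecMulVec_apply, mul_comm, hVt, fromRows_apply_inl, fromRows_apply_inr]

theorem R_to_C {n m k : ℕ} {ι : Type}
    {Q : ι → Matrix (Fin n × Fin m) (Fin n × Fin m) ℝ}
    {E : ι → Matrix (Fin n) (Fin m) ℝ} {b : ι → ℝ}
    {X : Matrix (Fin n) (Fin m) ℝ} {Y : Matrix (Fin n) (Fin n) ℝ}
    {Wxx : Matrix (Fin n × Fin m) (Fin n × Fin m) ℝ}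
    {Wxy : Matrix (Fin n × Fin m) (Fin n × Fin n) ℝ}
    {Wyy : Matrix (Fin n × Fin n) (Fin n × Fin n) ℝ}
    (h : FeasR k Q E b X Y Wxx Wxy Wyy) : FeasC k Q E b X Y Wxx := by
  obtain ⟨h1, h2, h3, h4, h5, h6, h7, h8, h9⟩ := h
  refine ⟨h1, h2, h3, h4, ?_, h9, ?_⟩
  · have a := h6.conjTranspose_mul_mul_same
      (fromRows (Matrix.of fun (_ : Unit) q => - vecXT X q) (fromRows (1 : Matrix (Fin n × Fin m) (Fin n × Fin m) ℝ) (0 : Matrix (Fin n × Fin n) (Fin n × Fin m) ℝ)))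
    convert a using 1
    rw [bigMat, Matrix.mul_assoc, fromBlocks_mul_fromRows,
      conjTranspose_eq_transpose_of_trivial, transpose_fromRows, transpose_fromRows,
      fromCols_mul_fromRows]
    ext i j
    simp [outer, Matrix.mul_apply, Matrix.one_apply]
    ring
  · have a : ∀ i : Fin n, ((bigMat X Y Wxx Wxy Wyy).submatrix
      (Sum.elim (fun j : Fin m => Sum.inr (Sum.inl (i, j)))
        (fun j : Fin n => Sum.inr (Sum.inr (i, j))))
      (Sum.elim (fun j : Fin m => Sum.inr (Sum.inl (i, j)))
        (fun j : Fin n => Sum.inr (Sum.inr (i, j))))).PosSemidef := fun i => h6.submatrix _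
    have s := posSemidef_sum Finset.univ (fun i _ => a i)
    convert s using 1
    ext (i | i) (j | j) <;> simp [Matrix.sum_apply, bigMat, h7, h8]

open scoped Kronecker in
theorem C_to_R {n m k : ℕ} {ι : Type}
    {Q : ι → Matrix (Fin n × Fin m) (Fin n × Fin m) ℝ}
    {E : ι → Matrix (Fin n) (Fin m) ℝ} {b : ι → ℝ}
    {X : Matrix (Fin n) (Fin m) ℝ} {Y : Matrix (Fin n) (Fin n) ℝ}
    {W : Matrix (Fin n × Fin m) (Fin n × Fin m) ℝ}
    (h : FeasC k Q E b X Y W) : ∃ Wxy Wyy, FeasR k Q E b X Y W Wxy Wyy := by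
  obtain ⟨h1, h2, h3, h4, h5, h6, h7⟩ := h
  have hY : Yᵀ = Y := by simpa using h1.isHermitian.eq
  obtain ⟨B, hB, hN⟩ := exists_solve_of_psd _ _ _ (compact_psd _ X Y hY h2 h7)
  set P : Matrix (Fin m) (Fin m) ℝ :=
    (Matrix.of fun j ℓ => ∑ i : Fin n, W (i, j) (i, ℓ)) - Xᵀ * X with hP
  set V := W - outer (vecXT X) (vecXT X) with hVd
  set N := Y - Y * Y - Bᵀ * P * B with hNd
  have hPV : ∀ j l, ∑ i : Fin n, V (i, j) (i, l) = P j l := by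
    intro j l
    simp [hVd, hP, outer, vecXT, Matrix.mul_apply, Finset.sum_sub_distrib]
  let Z : Matrix (Fin n × Fin m) (Fin n × Fin n) ℝ := (1 : Matrix (Fin n) (Fin n) ℝ) ⊗ₖ B
  let M : Matrix (Fin n × Fin n) (Fin n × Fin n) ℝ := (1 : Matrix (Fin n) (Fin n) ℝ) ⊗ₖ ((n : ℝ)⁻¹ • N)
  have hM : M.PosSemidef := PosSemidef.one.kronecker (hN.smul (by positivity))
  have big := lift_psd X Y V Z M h5 hM
  have hVW : V + outer (vecXT X) (vecXT X) = W := by simp [hVd]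
  rw [hVW] at big
  have hVZ : ∀ i j k' l, (V * Z) (i, j) (k', l) = ∑ a, V (i, j) (k', a) * B a l := by
    intro i j k' l
    simp [Z, Matrix.mul_apply, Fintype.sum_prod_type, Matrix.one_apply]
  have hZVZ : ∀ i j k' l, (Zᵀ * V * Z) (i, j) (k', l)
      = ∑ c, B c j * ∑ a, V (i, c) (k', a) * B a l := by
    intro i j k' l
    rw [Matrix.mul_assoc, Matrix.mul_apply, Fintype.sum_prod_type]
    simp only [hVZ]
    simp [Z, Matrix.one_apply]
  have key : ∀ j l, ∑ i : Fin n, ∑ a, V (i, j) (i, a) * B a l = (P * B) j l := by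
    intro j l
    rw [Finset.sum_comm]
    simp only [← Finset.sum_mul, hPV, Matrix.mul_apply]
  refine ⟨_, _, h1, h2, h3, h4, ?_, big, ?_, ?_, h6⟩
  · have := big.isHermitian
    ext i j
    have := this.apply (Sum.inr (Sum.inr i)) (Sum.inr (Sum.inr j))
    simpa [bigMat] using this
  · intro j l
    have hn : (n : ℝ) ≠ 0 := by
      have := j.pos
      positivity
    simp only [Matrix.add_apply, hZVZ, Finset.sum_add_distrib]
    rw [Finset.sum_comm]
    simp only [← Finset.mul_sum, key]
    have e1 : ∑ c, B c j * (P * B) c l = (Bᵀ * P * B) j l := by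
      rw [Matrix.mul_assoc, Matrix.mul_apply]; rfl
    have e2 : ∑ i : Fin n, M (i, j) (i, l) = N j l := by
      simp [M, hn]
    have e3 : ∑ i : Fin n, outer (vecSq Y) (vecSq Y) (i, j) (i, l) = (Y * Y) j l := by
      simp only [outer, vecSq, Matrix.of_apply, Matrix.mul_apply]
      refine Finset.sum_congr rfl fun i _ => ?_
      rw [← congrFun (congrFun hY i) l, transpose_apply]
    rw [e1, e2, e3, hNd]
    simp
  · intro j l
    simp only [Matrix.add_apply, hVZ, Finset.sum_add_distrib, key, hB]
    have e3 : ∑ i : Fin n, outer (vecXT X) (vecSq Y) (i, j) (i, l) = (Xᵀ * Y) j l := by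
      simp only [outer, vecSq, vecXT, Matrix.of_apply, Matrix.mul_apply]
      refine Finset.sum_congr rfl fun i _ => ?_
      rw [← congrFun (congrFun hY i) l, transpose_apply, transpose_apply]
    rw [e3, Matrix.mul_sub]
    simp

/-- Theorem 1 (elimination theorem): problems (R) and (C) have equal optimal values. -/
theorem elimination_theorem (n m k : ℕ) (ι : Type) [Fintype ι]
    (lam : ℝ) (hlam : 0 ≤ lam)
    (H : Matrix (Fin n × Fin m) (Fin n × Fin m) ℝ) (hH : H.IsSymm)
    (Q : ι → Matrix (Fin n × Fin m) (Fin n × Fin m) ℝ) (hQ : ∀ i, (Q i).IsSymm)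
    (D : Matrix (Fin n) (Fin m) ℝ) (E : ι → Matrix (Fin n) (Fin m) ℝ) (b : ι → ℝ) :
    sInf {v : EReal | ∃ (X : Matrix (Fin n) (Fin m) ℝ) (Y : Matrix (Fin n) (Fin n) ℝ)
        (Wxx : Matrix (Fin n × Fin m) (Fin n × Fin m) ℝ)
        (Wxy : Matrix (Fin n × Fin m) (Fin n × Fin n) ℝ)
        (Wyy : Matrix (Fin n × Fin n) (Fin n × Fin n) ℝ),
        FeasR k Q E b X Y Wxx Wxy Wyy ∧
        v = ((lam * Y.trace + fip Wxx H + fip D X : ℝ) : EReal)} =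
    sInf {v : EReal | ∃ (X : Matrix (Fin n) (Fin m) ℝ) (Y : Matrix (Fin n) (Fin n) ℝ)
        (W : Matrix (Fin n × Fin m) (Fin n × Fin m) ℝ),
        FeasC k Q E b X Y W ∧
        v = ((lam * Y.trace + fip W H + fip D X : ℝ) : EReal)} := by
  congr 1
  ext v
  constructor
  · rintro ⟨X, Y, Wxx, Wxy, Wyy, h, rfl⟩
    exact ⟨X, Y, Wxx, R_to_C h, rfl⟩
  · rintro ⟨X, Y, W, h, rfl⟩
    obtain ⟨Wxy, Wyy, h'⟩ := C_to_R h
    exact ⟨X, Y, W, Wxy, Wyy, h', rfl⟩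
end
end

section
/- (First direction of Theorem 1.) If (X, Y, W_xx, W_xy, W_yy) is feasible for problem (R), then (X, Y, W_xx) is feasible for problem (C). In particular, positive semidefiniteness of the large block-moment matrix in (R), together with the block-trace equalities ∑_{i∈[n]} W_xy^{(i,i)} = Xᵀ and ∑_{i∈[n]} W_yy^{(i,i)} = Y, implies both W_xx ⪰ vec(Xᵀ)vec(Xᵀ)ᵀ and positive semidefiniteness of the (m+n)×(m+n) block matrix [[∑_{i∈[n]} W_xx^{(i,i)}, Xᵀ],[X, Y]]. Since (R) and (C) have the same objective in (X, Y, W_xx), the optimal value of (C) is at most that of (R). -/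
open Matrix BigOperators

noncomputable section

/-- First direction of Theorem 1: every point feasible for (R) projects to a point
feasible for (C) with the same objective, hence the optimal value of (C) is at most
that of (R). -/
theorem elimination_first_direction (n m k : ℕ) (ι : Type) [Fintype ι]
    (lam : ℝ) (hlam : 0 ≤ lam)
    (H : Matrix (Fin n × Fin m) (Fin n × Fin m) ℝ) (hH : H.IsSymm)
    (Q : ι → Matrix (Fin n × Fin m) (Fin n × Fin m) ℝ) (hQ : ∀ i, (Q i).IsSymm)
    (D : Matrix (Fin n) (Fin m) ℝ) (E : ι → Matrix (Fin n) (Fin m) ℝ) (b : ι → ℝ) :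
    (∀ (X : Matrix (Fin n) (Fin m) ℝ) (Y : Matrix (Fin n) (Fin n) ℝ)
        (Wxx : Matrix (Fin n × Fin m) (Fin n × Fin m) ℝ)
        (Wxy : Matrix (Fin n × Fin m) (Fin n × Fin n) ℝ)
        (Wyy : Matrix (Fin n × Fin n) (Fin n × Fin n) ℝ),
        FeasR k Q E b X Y Wxx Wxy Wyy → FeasC k Q E b X Y Wxx) ∧
    sInf {v : EReal | ∃ (X : Matrix (Fin n) (Fin m) ℝ) (Y : Matrix (Fin n) (Fin n) ℝ)
        (W : Matrix (Fin n × Fin m) (Fin n × Fin m) ℝ),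
        FeasC k Q E b X Y W ∧
        v = ((lam * Y.trace + fip W H + fip D X : ℝ) : EReal)} ≤
    sInf {v : EReal | ∃ (X : Matrix (Fin n) (Fin m) ℝ) (Y : Matrix (Fin n) (Fin n) ℝ)
        (Wxx : Matrix (Fin n × Fin m) (Fin n × Fin m) ℝ)
        (Wxy : Matrix (Fin n × Fin m) (Fin n × Fin n) ℝ)
        (Wyy : Matrix (Fin n × Fin n) (Fin n × Fin n) ℝ),
        FeasR k Q E b X Y Wxx Wxy Wyy ∧
        v = ((lam * Y.trace + fip Wxx H + fip D X : ℝ) : EReal)} := by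
  have key : ∀ (X : Matrix (Fin n) (Fin m) ℝ) (Y : Matrix (Fin n) (Fin n) ℝ)
        (Wxx : Matrix (Fin n × Fin m) (Fin n × Fin m) ℝ)
        (Wxy : Matrix (Fin n × Fin m) (Fin n × Fin n) ℝ)
        (Wyy : Matrix (Fin n × Fin n) (Fin n × Fin n) ℝ),
        FeasR k Q E b X Y Wxx Wxy Wyy → FeasC k Q E b X Y Wxx := by
    rintro X Y Wxx Wxy Wyy ⟨hY, hY1, htr, hWx, hWy, hM, hyy, hxy, hQE⟩
    refine ⟨hY, hY1, htr, hWx, ?_, hQE, ?_⟩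
    · have h1 := hM.submatrix (Sum.map id Sum.inl : Unit ⊕ (Fin n × Fin m) → _)
      have h2 : (bigMat X Y Wxx Wxy Wyy).submatrix
          (Sum.map id Sum.inl : Unit ⊕ (Fin n × Fin m) → _) (Sum.map id Sum.inl)
          = Matrix.fromBlocks (1 : Matrix Unit Unit ℝ) (Matrix.of fun _ q => vecXT X q)
            (Matrix.of fun _ q => vecXT X q)ᴴ Wxx := by
        ext (a | a) (c | c) <;> simp [bigMat]
      rw [h2] at h1
      let _ : Invertible (1 : Matrix Unit Unit ℝ) := invertibleOne
      have h3 := (Matrix.PosDef.fromBlocks₁₁ (A := (1 : Matrix Unit Unit ℝ))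
        (Matrix.of fun (_ : Unit) q => vecXT X q) Wxx Matrix.PosDef.one).1 h1
      have h4 : Wxx - outer (vecXT X) (vecXT X) = Wxx - (Matrix.of fun (_ : Unit) q => vecXT X q)ᴴ
          * (1 : Matrix Unit Unit ℝ)⁻¹ * (Matrix.of fun (_ : Unit) q => vecXT X q) := by
        ext a c
        simp [outer, Matrix.mul_apply]
      rw [h4]
      exact h3
    · have h1 : (∑ i : Fin n, (bigMat X Y Wxx Wxy Wyy).submatrix
          (fun s : Fin m ⊕ Fin n => Sum.inr (Sum.map (fun j => (i, j)) (fun j => (i, j)) s))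
          (fun s : Fin m ⊕ Fin n => Sum.inr (Sum.map (fun j => (i, j)) (fun j => (i, j)) s))
          ).PosSemidef :=
        Matrix.posSemidef_sum _ (fun i _ => hM.submatrix _)
      convert h1 using 1
      ext (a | a) (c | c) <;> simp [bigMat, Matrix.sum_apply, hyy, hxy]
  refine ⟨key, sInf_le_sInf ?_⟩
  rintro v ⟨X, Y, Wxx, Wxy, Wyy, h, rfl⟩
  exact ⟨X, Y, Wxx, key _ _ _ _ _ h, rfl⟩
end
end

section
/- (Second direction of Theorem 1.) If (X, Y, W) is feasible for problem (C), then there exist a matrix Y' ∈ S^n with 0 ⪯ Y' ⪯ Y (hence 0 ⪯ Y' ⪯ I_n and tr(Y') ≤ tr(Y) ≤ k) and matrices W_xy ∈ ℝ^{nm×n·n}, W_yy ∈ S^{n·n} such that (X, Y', W, W_xy, W_yy) is feasible for problem (R). Consequently, since λ ≥ 0, the optimal value of (R) is at most that of (C). -/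
open Matrix BigOperators

noncomputable section

theorem exists_factor {n m : ℕ} (S : Matrix (Fin m) (Fin m) ℝ) (X : Matrix (Fin n) (Fin m) ℝ)
    (h : ∀ v, S *ᵥ v = 0 → X *ᵥ v = 0) : ∃ K : Matrix (Fin n) (Fin m) ℝ, X = K * S := by
  let f := Matrix.toLin' S
  let g := Matrix.toLin' X
  have hfg : LinearMap.ker f ≤ LinearMap.ker g := by
    intro v hv
    have hv' : S *ᵥ v = 0 := by simpa [f] using hv
    simpa [g] using h v hv'
  obtain ⟨l, hl⟩ := ((LinearMap.ker f).liftQ f le_rfl).exists_leftInverse_of_injective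
    (Submodule.ker_liftQ_eq_bot _ _ _ le_rfl)
  let q := (LinearMap.ker f).liftQ g hfg
  have hq : (q ∘ₗ l) ∘ₗ f = g := by
    refine LinearMap.ext fun v => ?_
    have := LinearMap.congr_fun hl (Submodule.Quotient.mk v)
    simp only [LinearMap.comp_apply, Submodule.liftQ_apply, LinearMap.id_apply] at this
    simp only [LinearMap.comp_apply]
    rw [this]
    simp [q]
  refine ⟨LinearMap.toMatrix' (q ∘ₗ l), ?_⟩
  have h2 := congrArg LinearMap.toMatrix' hq
  rw [LinearMap.toMatrix'_comp] at h2
  simpa [f, g] using h2.symm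

/-- The block diagonal matrix with `n` copies of `K`. -/
def blk {n m : ℕ} (K : Matrix (Fin n) (Fin m) ℝ) : Matrix (Fin n × Fin n) (Fin n × Fin m) ℝ :=
  Matrix.of fun p q => if p.1 = q.1 then K p.2 q.2 else 0

theorem mul_blkT {n m : ℕ} {α : Type*} (K : Matrix (Fin n) (Fin m) ℝ)
    (W : Matrix α (Fin n × Fin m) ℝ) (p : α) (i l : Fin n) :
    (W * (blk K)ᵀ) p (i, l) = ∑ b, W p (i, b) * K l b := by
  simp [Matrix.mul_apply, blk, Fintype.sum_prod_type]

theorem blk_mul {n m : ℕ} {α : Type*} (K : Matrix (Fin n) (Fin m) ℝ)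
    (W : Matrix (Fin n × Fin m) α ℝ) (p : α) (i l : Fin n) :
    (blk K * W) (i, l) p = ∑ b, K l b * W (i, b) p := by
  simp [Matrix.mul_apply, blk, Fintype.sum_prod_type]

theorem bigMat_psd {n m : ℕ} (X : Matrix (Fin n) (Fin m) ℝ) (Y : Matrix (Fin n) (Fin n) ℝ)
    (W : Matrix (Fin n × Fin m) (Fin n × Fin m) ℝ) (hW : W.IsSymm)
    (hV : (W - outer (vecXT X) (vecXT X)).PosSemidef)
    (G : Matrix (Fin n × Fin n) (Fin n × Fin m) ℝ) (hY : vecSq Y = G *ᵥ vecXT X) :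
    (bigMat X Y W (W * Gᵀ) (G * W * Gᵀ)).PosSemidef := by
  set x := vecXT X with hx
  let u : Unit ⊕ ((Fin n × Fin m) ⊕ (Fin n × Fin n)) → ℝ :=
    Sum.elim (fun _ => 1) (Sum.elim x (vecSq Y))
  let L : Matrix (Unit ⊕ ((Fin n × Fin m) ⊕ (Fin n × Fin n))) (Fin n × Fin m) ℝ :=
    Matrix.fromRows 0 (Matrix.fromRows 1 G)
  have h1 := posSemidef_vecMulVec_self_star u
  have h2 := hV.mul_mul_conjTranspose_same L
  have ho : outer x x = vecMulVec x x := rfl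
  have hc : G * outer x x = vecMulVec (vecSq Y) x := by
    rw [ho, hY, mul_vecMulVec]
  have hd : outer x x * Gᵀ = vecMulVec x (vecSq Y) := by
    rw [ho, hY, vecMulVec_mul, vecMul_transpose]
  have he : vecMulVec (vecSq Y) x * Gᵀ = vecMulVec (vecSq Y) (vecSq Y) := by
    rw [vecMulVec_mul, vecMul_transpose, ← hY]
  have hL : L * (W - outer x x) * Lᴴ = fromBlocks 0 0 0 (fromBlocks (W - outer x x)
      (W * Gᵀ - vecMulVec x (vecSq Y)) (G * W - vecMulVec (vecSq Y) x)
      (G * W * Gᵀ - vecMulVec (vecSq Y) (vecSq Y))) := by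
    have hg : G * (W - outer x x) * Gᵀ = G * W * Gᵀ - vecMulVec (vecSq Y) (vecSq Y) := by
      rw [Matrix.mul_sub, hc, Matrix.sub_mul, he]
    rw [← hg, ← hd, ← hc, ← Matrix.sub_mul, ← Matrix.mul_sub]
    simp only [L, conjTranspose_eq_transpose_of_trivial, transpose_fromRows, fromRows_mul,
      transpose_zero, transpose_one, mul_fromCols, Matrix.zero_mul, Matrix.mul_zero, Matrix.one_mul, Matrix.mul_one]
    ext (i | i | i) (j | j | j) <;> simp
  have hG : (W * Gᵀ)ᵀ = G * W := by rw [transpose_mul, transpose_transpose, hW.eq]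
  have h3 := h1.add h2
  rw [hL] at h3
  convert h3 using 1
  unfold bigMat
  rw [hG]
  ext (i | i | i) (j | j | j) <;> simp [u, vecMulVec_apply, outer, hx]

theorem second_dir {n m k : ℕ} {ι : Type}
    (Q : ι → Matrix (Fin n × Fin m) (Fin n × Fin m) ℝ)
    (E : ι → Matrix (Fin n) (Fin m) ℝ) (b : ι → ℝ)
    (X : Matrix (Fin n) (Fin m) ℝ) (Y : Matrix (Fin n) (Fin n) ℝ)
    (W : Matrix (Fin n × Fin m) (Fin n × Fin m) ℝ) (h : FeasC k Q E b X Y W) :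
    ∃ (Y' : Matrix (Fin n) (Fin n) ℝ)
      (Wxy : Matrix (Fin n × Fin m) (Fin n × Fin n) ℝ)
      (Wyy : Matrix (Fin n × Fin n) (Fin n × Fin n) ℝ),
      Y'.PosSemidef ∧ (Y - Y').PosSemidef ∧ FeasR k Q E b X Y' W Wxy Wyy := by
  obtain ⟨hY, hY1, hk, hW, hV, hQ, hM⟩ := h
  set S : Matrix (Fin m) (Fin m) ℝ := Matrix.of fun j ℓ => ∑ i : Fin n, W (i, j) (i, ℓ) with hS
  have hker : ∀ v, S *ᵥ v = 0 → X *ᵥ v = 0 := by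
    intro v hv
    have h0 := (hM.dotProduct_mulVec_zero_iff (Sum.elim v 0)).1 (by
      simp [fromBlocks_mulVec, hv, dotProduct, Fintype.sum_sum_type])
    rw [fromBlocks_mulVec] at h0
    ext i
    simpa using congrFun h0 (Sum.inr i)
  obtain ⟨K, hK⟩ := exists_factor S X hker
  have hSs : Sᵀ = S := by
    ext i j
    simp only [hS, transpose_apply, of_apply]
    exact Finset.sum_congr rfl fun a _ => hW.apply _ _
  have hSp : S.PosSemidef := by
    have := hM.submatrix Sum.inl
    convert this using 1
    ext i j
    simp
  have hXT : Xᵀ = S * Kᵀ := by rw [hK, transpose_mul, hSs]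
  have hY'p : (K * S * Kᵀ).PosSemidef := by
    simpa using hSp.mul_mul_conjTranspose_same K
  have hd : (Y - K * S * Kᵀ).PosSemidef := by
    have := hM.mul_mul_conjTranspose_same (fromCols (-K) (1 : Matrix (Fin n) (Fin n) ℝ))
    convert this using 1
    rw [fromCols_mul_fromBlocks, conjTranspose_eq_transpose_of_trivial, transpose_fromCols,
      fromCols_mul_fromRows, hXT, hK]
    simp [Matrix.mul_assoc]
    abel
  refine ⟨K * S * Kᵀ, W * (blk K)ᵀ, blk K * W * (blk K)ᵀ, hY'p, hd, hY'p, ?_, ?_, hW, ?_, ?_, ?_,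
    ?_, hQ⟩
  · convert hY1.add hd using 1
    abel
  · have := hd.trace_nonneg
    rw [trace_sub] at this
    linarith
  · unfold Matrix.IsSymm
    rw [transpose_mul, transpose_mul, transpose_transpose, hW.eq, Matrix.mul_assoc]
  · apply bigMat_psd X _ W hW hV
    ext ⟨i, l⟩
    rw [Matrix.mul_assoc, ← hXT]
    simp [vecSq, vecXT, mulVec, dotProduct, blk, Fintype.sum_prod_type, Matrix.mul_apply]
  · intro j l
    simp only [mul_blkT, blk_mul]
    rw [Finset.sum_comm]
    simp only [Matrix.mul_apply, hS, of_apply, transpose_apply, Finset.sum_mul, Finset.mul_sum]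
    refine Finset.sum_congr rfl fun a _ => ?_
    rw [Finset.sum_comm]
  · intro j l
    simp only [mul_blkT]
    have := congrFun (congrFun hXT j) l
    rw [transpose_apply] at this
    rw [this, Finset.sum_comm]
    simp [Matrix.mul_apply, hS, Finset.sum_mul]

/-- Second direction of Theorem 1: from any point feasible for (C) one can construct
`Y'` with `0 ⪯ Y' ⪯ Y` and blocks `Wxy, Wyy` so that `(X, Y', W, Wxy, Wyy)` is feasible
for (R); consequently (since `λ ≥ 0`) the optimal value of (R) is at most that of (C). -/
theorem elimination_second_direction (n m k : ℕ) (ι : Type) [Fintype ι]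
    (lam : ℝ) (hlam : 0 ≤ lam)
    (H : Matrix (Fin n × Fin m) (Fin n × Fin m) ℝ) (hH : H.IsSymm)
    (Q : ι → Matrix (Fin n × Fin m) (Fin n × Fin m) ℝ) (hQ : ∀ i, (Q i).IsSymm)
    (D : Matrix (Fin n) (Fin m) ℝ) (E : ι → Matrix (Fin n) (Fin m) ℝ) (b : ι → ℝ) :
    (∀ (X : Matrix (Fin n) (Fin m) ℝ) (Y : Matrix (Fin n) (Fin n) ℝ)
        (W : Matrix (Fin n × Fin m) (Fin n × Fin m) ℝ),
        FeasC k Q E b X Y W →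
        ∃ (Y' : Matrix (Fin n) (Fin n) ℝ)
          (Wxy : Matrix (Fin n × Fin m) (Fin n × Fin n) ℝ)
          (Wyy : Matrix (Fin n × Fin n) (Fin n × Fin n) ℝ),
          Y'.PosSemidef ∧ (Y - Y').PosSemidef ∧
          FeasR k Q E b X Y' W Wxy Wyy) ∧
    sInf {v : EReal | ∃ (X : Matrix (Fin n) (Fin m) ℝ) (Y : Matrix (Fin n) (Fin n) ℝ)
        (Wxx : Matrix (Fin n × Fin m) (Fin n × Fin m) ℝ)
        (Wxy : Matrix (Fin n × Fin m) (Fin n × Fin n) ℝ)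
        (Wyy : Matrix (Fin n × Fin n) (Fin n × Fin n) ℝ),
        FeasR k Q E b X Y Wxx Wxy Wyy ∧
        v = ((lam * Y.trace + fip Wxx H + fip D X : ℝ) : EReal)} ≤
    sInf {v : EReal | ∃ (X : Matrix (Fin n) (Fin m) ℝ) (Y : Matrix (Fin n) (Fin n) ℝ)
        (W : Matrix (Fin n × Fin m) (Fin n × Fin m) ℝ),
        FeasC k Q E b X Y W ∧
        v = ((lam * Y.trace + fip W H + fip D X : ℝ) : EReal)} := by
  have key := fun X Y W => second_dir (k := k) Q E b X Y W
  refine ⟨key, ?_⟩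
  apply le_sInf
  rintro v ⟨X, Y, W, hF, rfl⟩
  obtain ⟨Y', Wxy, Wyy, _, hd, hR⟩ := key X Y W hF
  refine le_trans (sInf_le ⟨X, Y', W, Wxy, Wyy, hR, rfl⟩) ?_
  have := hd.trace_nonneg
  rw [Matrix.trace_sub] at this
  have := mul_le_mul_of_nonneg_left (sub_nonneg.1 this) hlam
  exact EReal.coe_le_coe_iff.2 (by linarith)
end
end

section
/- Proposition 2. Suppose there exist γ > 0 and convex functions h, h_i : ℝ^{n×m} → ℝ (i ∈ I) such that for every X ∈ ℝ^{n×m}: ⟨H, vec(Xᵀ)vec(Xᵀ)ᵀ⟩ + ⟨D, X⟩ = (1/(2γ))·‖X‖_F² + h(X), and ⟨Q_i, vec(Xᵀ)vec(Xᵀ)ᵀ⟩ + ⟨E_i, X⟩ = (1/(2γ))·‖X‖_F² + h_i(X) for each i ∈ I. Then the optimal value of the lifted relaxation (R) is greater than or equal to the optimal value of the matrix-perspective relaxation (M). -/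
open Matrix BigOperators

noncomputable section

/-- Squared Frobenius norm. -/
def frob2 {n m : ℕ} (X : Matrix (Fin n) (Fin m) ℝ) : ℝ :=
  ∑ i, ∑ j, (X i j) ^ 2

/-- Feasibility for the matrix-perspective relaxation (M). -/
def FeasM {n m : ℕ} (k : ℕ) {ι : Type} (γ : ℝ)
    (h : ι → Matrix (Fin n) (Fin m) ℝ → ℝ) (b : ι → ℝ)
    (X : Matrix (Fin n) (Fin m) ℝ) (θ : Matrix (Fin m) (Fin m) ℝ)
    (Y : Matrix (Fin n) (Fin n) ℝ) : Prop :=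
  θ.PosSemidef ∧ Y.PosSemidef ∧ (1 - Y).PosSemidef ∧ Y.trace ≤ (k : ℝ) ∧
  (∀ i : ι, (1 / (2 * γ)) * θ.trace + h i X ≤ b i) ∧
  (Matrix.fromBlocks θ Xᵀ X Y).PosSemidef

lemma fip_nonneg_of_posSemidef {α : Type*} [Fintype α] {G V : Matrix α α ℝ}
    (hG : G.PosSemidef) (hV : V.PosSemidef) : 0 ≤ fip G V := by
  have h := (hG.hadamard hV).dotProduct_mulVec_nonneg (fun _ => 1)
  simpa [fip, dotProduct, mulVec, Matrix.hadamard] using h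

lemma fip_comm' {α β : Type*} [Fintype α] [Fintype β] (A B : Matrix α β ℝ) :
    fip A B = fip B A := by
  simp [fip, mul_comm]

lemma fip_sub_right {α β : Type*} [Fintype α] [Fintype β] (A B C : Matrix α β ℝ) :
    fip A (B - C) = fip A B - fip A C := by
  simp [fip, mul_sub, Finset.sum_sub_distrib]

lemma fip_sub_left {α β : Type*} [Fintype α] [Fintype β] (A B C : Matrix α β ℝ) :
    fip (A - B) C = fip A C - fip B C := by
  rw [fip_comm', fip_sub_right, fip_comm' C A, fip_comm' C B]

lemma fip_smul_one {α : Type*} [Fintype α] [DecidableEq α] (c : ℝ) (A : Matrix α α ℝ) :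
    fip (c • (1 : Matrix α α ℝ)) A = c * A.trace := by
  simp [fip, Matrix.one_apply, Matrix.trace, Finset.mul_sum]

lemma trace_outer_vecXT {n m : ℕ} (X : Matrix (Fin n) (Fin m) ℝ) :
    (outer (vecXT X) (vecXT X)).trace = frob2 X := by
  simp [outer, vecXT, frob2, Matrix.trace, Fintype.sum_prod_type, sq]

lemma covariance_posSemidef {n m : ℕ} {X : Matrix (Fin n) (Fin m) ℝ}
    {Y : Matrix (Fin n) (Fin n) ℝ}
    {Wxx : Matrix (Fin n × Fin m) (Fin n × Fin m) ℝ}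
    {Wxy : Matrix (Fin n × Fin m) (Fin n × Fin n) ℝ}
    {Wyy : Matrix (Fin n × Fin n) (Fin n × Fin n) ℝ}
    (hB : (bigMat X Y Wxx Wxy Wyy).PosSemidef) :
    (Wxx - outer (vecXT X) (vecXT X)).PosSemidef := by
  have h1 := hB.submatrix (Sum.map (fun u : Unit => u) (fun p : Fin n × Fin m => Sum.inl p))
  have h2 : (bigMat X Y Wxx Wxy Wyy).submatrix
      (Sum.map (fun u : Unit => u) (fun p : Fin n × Fin m => Sum.inl p))
      (Sum.map (fun u : Unit => u) (fun p : Fin n × Fin m => Sum.inl p))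
      = Matrix.fromBlocks (1 : Matrix Unit Unit ℝ) (Matrix.of fun _ q => vecXT X q)
        (Matrix.of fun (_ : Unit) q => vecXT X q)ᴴ Wxx := by
    ext (i | i) (j | j) <;> simp [bigMat]
  rw [h2] at h1
  have : Invertible (1 : Matrix Unit Unit ℝ) := invertibleOne
  have h3 := (Matrix.PosDef.fromBlocks₁₁ _ _ Matrix.PosDef.one).1 h1
  have h4 : (Matrix.of fun (_ : Unit) q => vecXT X q)ᴴ * (1 : Matrix Unit Unit ℝ)⁻¹
      * (Matrix.of fun (_ : Unit) q => vecXT X q) = outer (vecXT X) (vecXT X) := by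
    ext i j
    simp [outer, Matrix.mul_apply]
  rw [h4] at h3
  exact h3

lemma block_posSemidef {n m : ℕ} {X : Matrix (Fin n) (Fin m) ℝ}
    {Y : Matrix (Fin n) (Fin n) ℝ}
    {Wxx : Matrix (Fin n × Fin m) (Fin n × Fin m) ℝ}
    {Wxy : Matrix (Fin n × Fin m) (Fin n × Fin n) ℝ}
    {Wyy : Matrix (Fin n × Fin n) (Fin n × Fin n) ℝ}
    (hB : (bigMat X Y Wxx Wxy Wyy).PosSemidef)
    (hY : ∀ j ℓ : Fin n, ∑ i : Fin n, Wyy (i, j) (i, ℓ) = Y j ℓ)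
    (hX : ∀ j : Fin m, ∀ ℓ : Fin n, ∑ i : Fin n, Wxy (i, j) (i, ℓ) = X ℓ j) :
    (Matrix.fromBlocks (Matrix.of fun j ℓ => ∑ i : Fin n, Wxx (i, j) (i, ℓ)) Xᵀ X Y).PosSemidef := by
  have h1 := Matrix.posSemidef_sum Finset.univ (fun (i : Fin n) _ =>
    hB.submatrix (fun s : Fin m ⊕ Fin n =>
      Sum.inr (Sum.map (fun j => (i, j)) (fun j => (i, j)) s)))
  convert h1 using 1
  ext (i | i) (j | j) <;> simp [bigMat, Matrix.sum_apply, hX, hY]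

lemma key_ineq {n m : ℕ} (H : Matrix (Fin n × Fin m) (Fin n × Fin m) ℝ) (hH : H.IsSymm)
    (D : Matrix (Fin n) (Fin m) ℝ) (γ : ℝ)
    (h : Matrix (Fin n) (Fin m) ℝ → ℝ) (hconv : ConvexOn ℝ Set.univ h)
    (hobj : ∀ X : Matrix (Fin n) (Fin m) ℝ,
      fip H (outer (vecXT X) (vecXT X)) + fip D X = (1 / (2 * γ)) * frob2 X + h X)
    (X : Matrix (Fin n) (Fin m) ℝ) (W : Matrix (Fin n × Fin m) (Fin n × Fin m) ℝ)
    (hV : (W - outer (vecXT X) (vecXT X)).PosSemidef) :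
    (1 / (2 * γ)) * W.trace + h X ≤ fip H W + fip D X := by
  set c := 1 / (2 * γ) with hc
  have hh : ∀ Z, h Z = fip (H - c • 1) (outer (vecXT Z) (vecXT Z)) + fip D Z := by
    intro Z
    rw [fip_sub_left, fip_smul_one, trace_outer_vecXT]
    linarith [hobj Z]
  have hG : (H - c • (1 : Matrix (Fin n × Fin m) (Fin n × Fin m) ℝ)).PosSemidef := by
    refine .of_dotProduct_mulVec_nonneg ?_ (fun z => ?_)
    · have : (H - c • (1 : Matrix (Fin n × Fin m) (Fin n × Fin m) ℝ)).IsSymm :=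
        hH.sub (Matrix.isSymm_one.smul c)
      simpa [Matrix.IsHermitian, Matrix.IsSymm] using this
    · let Z : Matrix (Fin n) (Fin m) ℝ := Matrix.of fun i j => z (i, j)
      have h0 : h 0 = 0 := by
        rw [hh]; simp [fip, outer, vecXT]
      have h2 := hconv.2 (Set.mem_univ Z) (Set.mem_univ (-Z))
        (show (0:ℝ) ≤ 1/2 by norm_num) (show (0:ℝ) ≤ 1/2 by norm_num) (by norm_num)
      rw [smul_neg, add_neg_cancel, h0, hh Z, hh (-Z)] at h2
      have e1 : outer (vecXT (-Z)) (vecXT (-Z)) = outer (vecXT Z) (vecXT Z) := by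
        ext; simp [outer, vecXT]
      have e2 : fip D (-Z) = - fip D Z := by simp [fip]
      rw [e1, e2] at h2
      have e3 : star z ⬝ᵥ ((H - c • (1 : Matrix (Fin n × Fin m) (Fin n × Fin m) ℝ)) *ᵥ z)
          = fip (H - c • 1) (outer (vecXT Z) (vecXT Z)) := by
        simp only [fip, outer, vecXT, Z, dotProduct, mulVec, Finset.mul_sum, star_trivial,
          Matrix.of_apply]
        refine Finset.sum_congr rfl fun i _ => Finset.sum_congr rfl fun j _ => ?_
        ring
      rw [e3]
      simp only [smul_eq_mul] at h2
      linarith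
  have h3 := fip_nonneg_of_posSemidef hG hV
  rw [fip_sub_right, fip_sub_left, fip_smul_one] at h3
  linarith [hh X]

/-- Proposition 2: if the quadratic objective and constraints are partially separable,
with a `(1/(2γ))‖X‖_F²` term plus a convex function, then the optimal value of the lifted
relaxation (R) is at least the optimal value of the matrix-perspective relaxation (M). -/
theorem mprt_is_weaker (n m k : ℕ) (ι : Type) [Fintype ι]
    (lam : ℝ) (hlam : 0 ≤ lam)
    (H : Matrix (Fin n × Fin m) (Fin n × Fin m) ℝ) (hH : H.IsSymm)
    (Q : ι → Matrix (Fin n × Fin m) (Fin n × Fin m) ℝ) (hQ : ∀ i, (Q i).IsSymm)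
    (D : Matrix (Fin n) (Fin m) ℝ) (E : ι → Matrix (Fin n) (Fin m) ℝ) (b : ι → ℝ)
    (γ : ℝ) (hγ : 0 < γ)
    (h : Matrix (Fin n) (Fin m) ℝ → ℝ) (hconv : ConvexOn ℝ Set.univ h)
    (hC : ι → Matrix (Fin n) (Fin m) ℝ → ℝ) (hCconv : ∀ i, ConvexOn ℝ Set.univ (hC i))
    (hobj : ∀ X : Matrix (Fin n) (Fin m) ℝ,
      fip H (outer (vecXT X) (vecXT X)) + fip D X = (1 / (2 * γ)) * frob2 X + h X)
    (hcon : ∀ (i : ι) (X : Matrix (Fin n) (Fin m) ℝ),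
      fip (Q i) (outer (vecXT X) (vecXT X)) + fip (E i) X
        = (1 / (2 * γ)) * frob2 X + hC i X) :
    sInf {v : EReal | ∃ (X : Matrix (Fin n) (Fin m) ℝ) (θ : Matrix (Fin m) (Fin m) ℝ)
        (Y : Matrix (Fin n) (Fin n) ℝ),
        FeasM k γ hC b X θ Y ∧
        v = ((lam * Y.trace + (1 / (2 * γ)) * θ.trace + h X : ℝ) : EReal)} ≤
    sInf {v : EReal | ∃ (X : Matrix (Fin n) (Fin m) ℝ) (Y : Matrix (Fin n) (Fin n) ℝ)
        (Wxx : Matrix (Fin n × Fin m) (Fin n × Fin m) ℝ)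
        (Wxy : Matrix (Fin n × Fin m) (Fin n × Fin n) ℝ)
        (Wyy : Matrix (Fin n × Fin n) (Fin n × Fin n) ℝ),
        FeasR k Q E b X Y Wxx Wxy Wyy ∧
        v = ((lam * Y.trace + fip Wxx H + fip D X : ℝ) : EReal)} := by
  refine le_sInf ?_
  rintro v ⟨X, Y, Wxx, Wxy, Wyy, ⟨hY0, hY1, hYk, -, -, hB, hYs, hXs, hQc⟩, rfl⟩
  have hV := covariance_posSemidef hB
  have hBl := block_posSemidef hB hYs hXs
  have htr : (Matrix.of fun j ℓ => ∑ i : Fin n, Wxx (i, j) (i, ℓ)).trace = Wxx.trace := by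
    simp only [Matrix.trace, Matrix.diag, Matrix.of_apply, Fintype.sum_prod_type]
    exact Finset.sum_comm
  refine le_trans (b := ((lam * Y.trace + (1 / (2 * γ)) *
    (Matrix.of fun j ℓ => ∑ i : Fin n, Wxx (i, j) (i, ℓ)).trace + h X : ℝ) : EReal))
    (sInf_le ⟨X, _, Y, ⟨?_, hY0, hY1, hYk, fun i => ?_, hBl⟩, rfl⟩) ?_
  · exact hBl.submatrix Sum.inl
  · rw [htr]
    exact (key_ineq (Q i) (hQ i) (E i) γ (hC i) (hCconv i) (hcon i) X Wxx hV).trans (hQc i)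
  · rw [htr, EReal.coe_le_coe_iff, fip_comm' Wxx H]
    linarith [key_ineq H hH D γ h hconv hobj X Wxx hV]
end
end

section
/- Proposition 4. The reduced-rank-regression relaxations (RR1) and (RR2) have equal optimal values. -/
open Matrix BigOperators

noncomputable section

/-- `vec(X) ∈ ℝ^{pm}` for `X ∈ ℝ^{p×m}` (columns stacked), indexed by pairs
`(i,a) ∈ [m]×[p]` with value `X a i`. -/
def vecC {p m : ℕ} (X : Matrix (Fin p) (Fin m) ℝ) : Fin m × Fin p → ℝ :=
  fun q => X q.2 q.1

theorem aux_schur {m p : ℕ} (X : Matrix (Fin p) (Fin m) ℝ) (Y : Matrix (Fin m) (Fin m) ℝ)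
    (θ : Matrix (Fin p) (Fin p) ℝ) (hY : (1 - Y).PosSemidef)
    (h : (Matrix.fromBlocks θ X Xᵀ Y).PosSemidef) : (θ - X * Xᵀ).PosSemidef := by
  have h1 := h.mul_mul_conjTranspose_same (Matrix.fromCols (1 : Matrix (Fin p) (Fin p) ℝ) (-X))
  have h2 := hY.mul_mul_conjTranspose_same X
  have h3 := h1.add h2
  convert h3 using 1
  rw [Matrix.conjTranspose_fromCols_eq_fromRows_conjTranspose, Matrix.fromCols_mul_fromBlocks,
    Matrix.fromCols_mul_fromRows]
  simp only [Matrix.conjTranspose_eq_transpose_of_trivial, Matrix.transpose_neg,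
    Matrix.transpose_one, Matrix.one_mul, Matrix.mul_one, Matrix.neg_mul, Matrix.mul_neg,
    Matrix.add_mul, Matrix.mul_sub, Matrix.sub_mul]
  abel

theorem aux_outer {α : Type*} [Fintype α] (u : α → ℝ) : (outer u u).PosSemidef := by
  have := Matrix.posSemidef_vecMulVec_self_star u
  convert this using 1
  ext i j
  simp [outer, Matrix.vecMulVec_apply]

theorem aux_fip {n p : ℕ} (A : Matrix (Fin n) (Fin p) ℝ) (θ : Matrix (Fin p) (Fin p) ℝ)
    (h : θ.PosSemidef) : 0 ≤ fip (Aᵀ * A) θ := by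
  have h1 := (h.mul_mul_conjTranspose_same A).trace_nonneg
  have h2 : fip (Aᵀ * A) θ = (A * θ * Aᴴ).trace := by
    rw [Matrix.conjTranspose_eq_transpose_of_trivial, Matrix.trace_mul_comm, ← Matrix.mul_assoc,
      ← Matrix.trace_transpose]
    have : θᵀ = θ := by
      rw [← Matrix.conjTranspose_eq_transpose_of_trivial]; exact h.1
    rw [Matrix.transpose_mul, this, Matrix.trace_mul_comm]
    have h3 : (Aᵀ * A)ᵀ = Aᵀ * A := by simp
    rw [h3]
    have h4 : ∀ i j, θ i j = θ j i := fun i j => by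
      conv_lhs => rw [← this]
      rfl
    simp only [fip, Matrix.trace, Matrix.diag]
    refine Finset.sum_congr rfl fun i _ => ?_
    rw [Matrix.mul_apply (M := Aᵀ * A)]
    exact Finset.sum_congr rfl fun j _ => by rw [h4 i j]
  rw [h2]; exact h1

/-- Proposition 4: the reduced-rank-regression relaxations (RR1) and (RR2) have equal
optimal values. -/
theorem reduced_rank_regression_equivalence (n m p : ℕ)
    (A : Matrix (Fin n) (Fin p) ℝ) (B : Matrix (Fin n) (Fin m) ℝ)
    (μ : ℝ) (hμ : 0 < μ) :
    sInf {v : EReal | ∃ (X : Matrix (Fin p) (Fin m) ℝ) (Y : Matrix (Fin m) (Fin m) ℝ)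
        (W : Matrix (Fin m × Fin p) (Fin m × Fin p) ℝ),
        (Y.PosSemidef ∧ (1 - Y).PosSemidef ∧
         W.IsSymm ∧
         (W - outer (vecC X) (vecC X)).PosSemidef ∧
         (Matrix.fromBlocks (Matrix.of fun a b => ∑ i : Fin m, W (i, a) (i, b))
            X Xᵀ Y).PosSemidef) ∧
        v = ((fip (Aᵀ * A) (Matrix.of fun a b => ∑ i : Fin m, W (i, a) (i, b))
              + fip B B - 2 * fip (A * X) B + μ * Y.trace : ℝ) : EReal)} =
    sInf {v : EReal | ∃ (X : Matrix (Fin p) (Fin m) ℝ) (Y : Matrix (Fin m) (Fin m) ℝ)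
        (θ : Matrix (Fin p) (Fin p) ℝ),
        (Y.PosSemidef ∧ (1 - Y).PosSemidef ∧
         θ.PosSemidef ∧
         (Matrix.fromBlocks θ X Xᵀ Y).PosSemidef) ∧
        v = ((fip (Aᵀ * A) θ + fip B B - 2 * fip (A * X) B
              + μ * Y.trace : ℝ) : EReal)} := by
  apply le_antisymm
  · apply le_sInf
    rintro v ⟨X, Y, θ, ⟨hY, hY1, hθ, hM⟩, rfl⟩
    have hD := aux_schur X Y θ hY1 hM
    rcases Nat.eq_zero_or_pos m with hm | hm
    · subst hm
      refine sInf_le_of_le ⟨X, Y, 0, ⟨hY, hY1, by simp [Matrix.IsSymm], ?_, ?_⟩, rfl⟩ ?_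
      · convert Matrix.PosSemidef.zero (n := Fin 0 × Fin p) (R := ℝ) using 1
        ext i; exact i.1.elim0
      · convert Matrix.PosSemidef.zero (n := Fin p ⊕ Fin 0) (R := ℝ) using 1
        ext i j
        rcases i with i | i
        · rcases j with j | j
          · simp
          · exact j.elim0
        · exact i.elim0
      · rw [EReal.coe_le_coe_iff]
        have := aux_fip A θ hθ
        have h0 : fip (Aᵀ * A) (Matrix.of fun a b => ∑ i : Fin 0,
          (0 : Matrix (Fin 0 × Fin p) (Fin 0 × Fin p) ℝ) (i, a) (i, b)) = 0 := by
          simp [fip]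
        rw [h0]
        linarith
    · have hm' : (m : ℝ) ≠ 0 := by positivity
      let K : Matrix (Fin m × Fin p) (Fin m × Fin p) ℝ :=
        Matrix.kroneckerMap (· * ·) ((1 / (m : ℝ)) • (1 : Matrix (Fin m) (Fin m) ℝ)) (θ - X * Xᵀ)
      have hK : K.PosSemidef :=
        Matrix.PosSemidef.kronecker (Matrix.PosSemidef.one.smul (by positivity)) hD
      have hW : (Matrix.of fun a b => ∑ i : Fin m,
          (outer (vecC X) (vecC X) + K) (i, a) (i, b)) = θ := by
        ext a b
        simp only [Matrix.of_apply, Matrix.add_apply, Finset.sum_add_distrib, K,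
          Matrix.kroneckerMap_apply, outer, vecC, Matrix.smul_apply, Matrix.one_apply_eq,
          Finset.sum_const, Finset.card_univ, Fintype.card_fin, Matrix.sub_apply,
          Matrix.mul_apply, Matrix.transpose_apply, smul_eq_mul, nsmul_eq_mul]
        field_simp
        ring
      refine sInf_le ⟨X, Y, outer (vecC X) (vecC X) + K, ⟨hY, hY1, ?_, ?_, ?_⟩, ?_⟩
      · have := ((aux_outer (vecC X)).add hK).1
        rw [Matrix.IsHermitian, Matrix.conjTranspose_eq_transpose_of_trivial] at this
        exact this
      · simpa using hK
      · rw [hW]; exact hM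
      · rw [hW]
  · apply le_sInf
    rintro v ⟨X, Y, W, ⟨hY, hY1, hW, hWX, hM⟩, rfl⟩
    exact sInf_le ⟨X, Y, _, ⟨hY, hY1, hM.submatrix Sum.inl, hM⟩, rfl⟩
end
end
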